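/- arXiv:0906.2586 — 2 statements merged into one kernel-verified Lean document; each statement's English description precedes it below -/
import Mathlib

section
/- Suppose the sequence {F_n} converges pointwise on [0, ∞) to a continuous function F. Then there exist d ≥ 0 and a σ-finite measure Λ₂ on (0, ∞) with ∫₀^∞ (1 ∧ u) Λ₂(du) < ∞ such that F(λ) = dλ + ∫₀^∞ (1 − e^{−λu}) Λ₂(du) for all λ ≥ 0. -/
open MeasureTheory Filter Topology

/-- The probability generating function of an `ℕ`-valued distribution `q`. -/
noncomputable def pgf (q : ℕ → ℝ) (s : ℝ) : ℝ := ∑' i, q i * s ^ i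

/-- `F_n(λ) = n [1 − h_n(1 − λ/b_n)]`. -/
noncomputable def Fseq (q : ℕ → ℕ → ℝ) (b : ℕ → ℝ) (n : ℕ) (l : ℝ) : ℝ :=
  (n : ℝ) * (1 - pgf (q n) (1 - l / b n))

section RpowSlope

/-- The slope of `x ↦ x ^ l` at `1`, i.e. `(1 - x ^ l) / (1 - x)`, extended by `l` at `x = 1`. -/
noncomputable def rpowSlope (l x : ℝ) : ℝ := dslope (fun y : ℝ => y ^ l) 1 x

lemma continuous_rpowSlope {l : ℝ} (hl : 0 < l) : Continuous (rpowSlope l) := by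
  rw [← continuousOn_univ]
  refine (continuousOn_dslope Filter.univ_mem).2
    ⟨(Real.continuous_rpow_const hl.le).continuousOn, ?_⟩
  exact Real.differentiableAt_rpow_const_of_ne l one_ne_zero

lemma rpowSlope_one (l : ℝ) : rpowSlope l 1 = l := by
  simp [rpowSlope]

lemma one_sub_mul_rpowSlope (l x : ℝ) : (1 - x) * rpowSlope l x = 1 - x ^ l := by
  have h := sub_smul_dslope (fun y : ℝ => y ^ l) 1 x
  simp only [smul_eq_mul, Real.one_rpow] at h
  unfold rpowSlope
  linarith

lemma rpowSlope_of_ne {l x : ℝ} (hx : x ≠ 1) : rpowSlope l x = (1 - x ^ l) / (1 - x) := by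
  rw [← one_sub_mul_rpowSlope, mul_div_cancel_left₀ _ (sub_ne_zero.2 hx.symm)]

lemma rpowSlope_zero {l : ℝ} (hl : l ≠ 0) : rpowSlope l 0 = 1 := by
  simpa [Real.zero_rpow hl] using one_sub_mul_rpowSlope l 0

lemma rpowSlope_one_left (x : ℝ) : rpowSlope 1 x = 1 := by
  rcases eq_or_ne x 1 with rfl | hx
  · exact rpowSlope_one 1
  · rw [rpowSlope_of_ne hx, Real.rpow_one, div_self (sub_ne_zero.2 hx.symm)]

lemma rpowSlope_nonneg {l x : ℝ} (hl : 0 < l) (hx0 : 0 ≤ x) (hx1 : x ≤ 1) :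
    0 ≤ rpowSlope l x := by
  rcases eq_or_ne x 1 with rfl | hx
  · rw [rpowSlope_one]; exact hl.le
  · rw [rpowSlope_of_ne hx]
    exact div_nonneg (sub_nonneg.2 (Real.rpow_le_one hx0 hx1 hl.le)) (sub_nonneg.2 hx1)

end RpowSlope

section GeneratingFunction

variable {q : ℕ → ℝ}

lemma summable_of_tsum_eq_one (hq1 : ∑' i, q i = 1) : Summable q :=
  not_not.1 fun h => one_ne_zero (hq1.symm.trans (tsum_eq_zero_of_not_summable h))

lemma summable_pgf (hq0 : ∀ i, 0 ≤ q i) (hq : Summable q) {s : ℝ} (hs0 : 0 ≤ s) (hs1 : s ≤ 1) :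
    Summable fun i => q i * s ^ i :=
  hq.of_nonneg_of_le (fun i => mul_nonneg (hq0 i) (pow_nonneg hs0 i))
    fun i => mul_le_of_le_one_right (hq0 i) (pow_le_one₀ hs0 hs1)

lemma pgf_mono (hq0 : ∀ i, 0 ≤ q i) (hq : Summable q) {s t : ℝ} (hs0 : 0 ≤ s) (hst : s ≤ t)
    (ht1 : t ≤ 1) : pgf q s ≤ pgf q t :=
  (summable_pgf hq0 hq hs0 (hst.trans ht1)).tsum_le_tsum
    (fun i => mul_le_mul_of_nonneg_left (pow_le_pow_left₀ hs0 hst i) (hq0 i))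
    (summable_pgf hq0 hq (hs0.trans hst) ht1)

lemma pgf_one (hq1 : ∑' i, q i = 1) : pgf q 1 = 1 := by simpa [pgf] using hq1

end GeneratingFunction

section Rescaling

variable {q : ℕ → ℕ → ℝ} {b : ℕ → ℝ}

lemma Fseq_zero (hq1 : ∀ n, ∑' i, q n i = 1) (n : ℕ) : Fseq q b n 0 = 0 := by
  simp [Fseq, pgf_one (hq1 n)]

lemma Fseq_mono (hq0 : ∀ n i, 0 ≤ q n i) (hq1 : ∀ n, ∑' i, q n i = 1) {n : ℕ} (hb : 0 < b n)
    {l l' : ℝ} (hl : 0 ≤ l) (hll' : l ≤ l') (hl' : l' ≤ b n) :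
    Fseq q b n l ≤ Fseq q b n l' := by
  refine mul_le_mul_of_nonneg_left (sub_le_sub_left ?_ _) n.cast_nonneg
  refine pgf_mono (hq0 n) (summable_of_tsum_eq_one (hq1 n)) ?_ ?_ ?_
  · rw [sub_nonneg]; exact div_le_one_of_le₀ hl' hb.le
  · gcongr
  · rw [sub_le_self_iff]; exact div_nonneg hl hb.le

lemma tendsto_mul_one_sub_exp (hbpos : ∀ n, 0 < b n) (hbtop : Tendsto b atTop atTop) (l : ℝ) :
    Tendsto (fun n => b n * (1 - Real.exp (-l / b n))) atTop (𝓝 l) := by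
  have hd : HasDerivAt (fun x : ℝ => 1 - Real.exp (-l * x)) l 0 := by
    have h := ((hasDerivAt_id (0 : ℝ)).const_mul (-l)).exp.const_sub 1
    simpa using h
  have ht : Tendsto (fun n => (b n)⁻¹) atTop (𝓝[≠] (0 : ℝ)) :=
    tendsto_nhdsWithin_iff.2 ⟨tendsto_inv_atTop_zero.comp hbtop,
      Eventually.of_forall fun n => (inv_pos.2 (hbpos n)).ne'⟩
  refine (hd.tendsto_slope_zero.comp ht).congr fun n => ?_
  simp [div_eq_mul_inv]

/-- Replacing `1 - l / b n` by `exp (-l / b n)` does not change the limit. -/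
lemma tendsto_pgf_exp (hq0 : ∀ n i, 0 ≤ q n i) (hq1 : ∀ n, ∑' i, q n i = 1)
    (hbpos : ∀ n, 0 < b n) (hbtop : Tendsto b atTop atTop) {F : ℝ → ℝ}
    (hconv : ∀ l : ℝ, 0 ≤ l → Tendsto (fun n => Fseq q b n l) atTop (𝓝 (F l)))
    (hFcont : ContinuousOn F (Set.Ici 0)) {l : ℝ} (hl : 0 < l) :
    Tendsto (fun n : ℕ => (n : ℝ) * (1 - pgf (q n) (Real.exp (-l / b n)))) atTop (𝓝 (F l)) := by
  have heq (n : ℕ) : (n : ℝ) * (1 - pgf (q n) (Real.exp (-l / b n))) =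
      Fseq q b n (b n * (1 - Real.exp (-l / b n))) := by
    rw [Fseq, mul_div_cancel_left₀ _ (hbpos n).ne', sub_sub_cancel]
  simp_rw [heq]
  have hle (n : ℕ) : b n * (1 - Real.exp (-l / b n)) ≤ l := by
    have h := Real.add_one_le_exp (-l / b n)
    calc b n * (1 - Real.exp (-l / b n)) ≤ b n * (l / b n) := by
          refine mul_le_mul_of_nonneg_left ?_ (hbpos n).le
          rw [neg_div] at h ⊢; linarith
      _ = l := mul_div_cancel₀ _ (hbpos n).ne'
  refine tendsto_order.2 ⟨fun a ha => ?_, fun a ha => ?_⟩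
  · have hFl : ContinuousAt F l := hFcont.continuousAt (Ici_mem_nhds hl)
    have hev : ∀ᶠ x in 𝓝[<] l, a < F x ∧ 0 < x :=
      ((hFl.eventually (lt_mem_nhds ha)).and (lt_mem_nhds hl)).filter_mono nhdsWithin_le_nhds
    obtain ⟨l', ⟨hal', hl'⟩, hl'l⟩ := (hev.and self_mem_nhdsWithin).exists
    filter_upwards [(hconv l' hl'.le).eventually (lt_mem_nhds hal'),
      (tendsto_mul_one_sub_exp hbpos hbtop l).eventually (lt_mem_nhds hl'l),
      hbtop.eventually_ge_atTop l] with n h1 h2 h3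
    exact h1.trans_le (Fseq_mono hq0 hq1 (hbpos n) hl'.le h2.le ((hle n).trans h3))
  · filter_upwards [(hconv l hl.le).eventually (gt_mem_nhds ha),
      hbtop.eventually_ge_atTop l] with n h1 h2
    refine (Fseq_mono hq0 hq1 (hbpos n) ?_ (hle n) h2).trans_lt h1
    refine mul_nonneg (hbpos n).le (sub_nonneg.2 (Real.exp_le_one_iff.2 ?_))
    exact div_nonpos_of_nonpos_of_nonneg (neg_nonpos.2 hl.le) (hbpos n).le

end Rescaling

section DiscreteMeasure

/-- The point `exp (-i / c)` of the unit interval. -/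
noncomputable def expPoint (c : ℝ) (hc : 0 < c) (i : ℕ) : unitInterval :=
  ⟨Real.exp (-1 / c) ^ i, pow_nonneg (Real.exp_pos _).le i,
    pow_le_one₀ (Real.exp_pos _).le (Real.exp_le_one_iff.2
      (div_nonpos_of_nonpos_of_nonneg (by norm_num) hc.le))⟩

lemma expPoint_rpow {c : ℝ} (hc : 0 < c) (i : ℕ) (l : ℝ) :
    (expPoint c hc i : ℝ) ^ l = Real.exp (-l / c) ^ i := by
  simp only [expPoint, ← Real.exp_nat_mul, ← Real.exp_mul]
  congr 1
  ring

/-- A generating function, tested at `exp (-l / c)`, is a mixture of the slopes `rpowSlope l`. -/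
lemma exists_finiteMeasure_integral_rpowSlope {q : ℕ → ℝ} (hq0 : ∀ i, 0 ≤ q i)
    (hq1 : ∑' i, q i = 1) {c : ℝ} (hc : 0 < c) (m : ℕ) :
    ∃ μ : FiniteMeasure unitInterval, ∀ l : ℝ, 0 < l →
      ∫ x, rpowSlope l (x : ℝ) ∂(μ : Measure unitInterval) =
        m * (1 - pgf q (Real.exp (-l / c))) := by
  have hq := summable_of_tsum_eq_one hq1
  let x := expPoint c hc
  let w : ℕ → ℝ := fun i => m * q i * (1 - x i)
  have hw0 (i : ℕ) : 0 ≤ w i :=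
    mul_nonneg (mul_nonneg m.cast_nonneg (hq0 i)) (sub_nonneg.2 (x i).2.2)
  have hw : Summable w := by
    refine (hq.mul_left (m : ℝ)).of_nonneg_of_le hw0 fun i => ?_
    exact mul_le_of_le_one_right (mul_nonneg m.cast_nonneg (hq0 i)) (sub_le_self _ (x i).2.1)
  let ν : Measure unitInterval := Measure.sum fun i => ENNReal.ofReal (w i) • Measure.dirac (x i)
  have hν : IsFiniteMeasure ν := by
    refine ⟨?_⟩
    simp only [ν, Measure.sum_apply _ MeasurableSet.univ, Measure.smul_apply, measure_univ,
      smul_eq_mul, mul_one]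
    rw [← ENNReal.ofReal_tsum_of_nonneg hw0 hw]
    exact ENNReal.ofReal_lt_top
  refine ⟨⟨ν, hν⟩, fun l hl => ?_⟩
  have hcont : Continuous fun y : unitInterval => rpowSlope l (y : ℝ) :=
    (continuous_rpowSlope hl).comp continuous_subtype_val
  have hint : Integrable (fun y : unitInterval => rpowSlope l (y : ℝ)) ν :=
    hcont.integrable_of_hasCompactSupport (HasCompactSupport.of_compactSpace _)
  have hs : Summable fun i => q i * Real.exp (-l / c) ^ i :=
    summable_pgf hq0 hq (Real.exp_pos _).le (Real.exp_le_one_iff.2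
      (div_nonpos_of_nonpos_of_nonneg (neg_nonpos.2 hl.le) hc.le))
  change ∫ y, rpowSlope l (y : ℝ) ∂ν = _
  rw [integral_sum_measure hint]
  calc ∑' i, ∫ y, rpowSlope l (y : ℝ) ∂(ENNReal.ofReal (w i) • Measure.dirac (x i))
      = ∑' i, m * (q i - q i * Real.exp (-l / c) ^ i) := by
        refine tsum_congr fun i => ?_
        rw [integral_smul_measure, integral_dirac, ENNReal.toReal_ofReal (hw0 i), smul_eq_mul,
          mul_assoc, one_sub_mul_rpowSlope, expPoint_rpow]
        ring
    _ = m * (1 - pgf q (Real.exp (-l / c))) := by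
        rw [tsum_mul_left, hq.tsum_sub hs, hq1, pgf]

end DiscreteMeasure

section Limit

/-- Mixtures of the slopes `rpowSlope l` are closed under pointwise limits. -/
lemma exists_finiteMeasure_of_tendsto {μ : ℕ → FiniteMeasure unitInterval} {F : ℝ → ℝ}
    (h : ∀ l : ℝ, 0 < l → Tendsto (fun n => ∫ x, rpowSlope l (x : ℝ) ∂(μ n : Measure unitInterval))
      atTop (𝓝 (F l))) :
    ∃ ν : FiniteMeasure unitInterval, ∀ l : ℝ, 0 < l →
      F l = ∫ x, rpowSlope l (x : ℝ) ∂(ν : Measure unitInterval) := by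
  have hmass : Tendsto (fun n => ((μ n).mass : ℝ)) atTop (𝓝 (F 1)) := by
    refine (h 1 one_pos).congr fun n => ?_
    simp_rw [rpowSlope_one_left, integral_const, smul_eq_mul, mul_one]
    rfl
  obtain ⟨C, hC⟩ : ∃ C : NNReal, ∀ᶠ n in atTop, (μ n).mass ≤ C := by
    refine ⟨Real.toNNReal (F 1 + 1), ?_⟩
    filter_upwards [hmass.eventually (gt_mem_nhds (lt_add_one (F 1)))] with n hn
    rw [← NNReal.coe_le_coe]
    exact hn.le.trans (Real.le_coe_toNNReal _)
  have hU : (hyperfilter ℕ : Filter ℕ) ≤ atTop := Nat.hyperfilter_le_atTop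
  obtain ⟨ν, -, hν⟩ :=
    (isCompact_setOfPred_finiteMeasure_le_of_compactSpace unitInterval C).ultrafilter_le_nhds'
      ((hyperfilter ℕ).map μ) (hU hC)
  refine ⟨ν, fun l hl => tendsto_nhds_unique ((h l hl).mono_left hU) ?_⟩
  let f : BoundedContinuousFunction unitInterval ℝ := BoundedContinuousFunction.mkOfCompact
    ⟨fun x => rpowSlope l (x : ℝ), (continuous_rpowSlope hl).comp continuous_subtype_val⟩
  have ht : Tendsto μ (hyperfilter ℕ : Filter ℕ) (𝓝 ν) := hν
  exact FiniteMeasure.tendsto_iff_forall_integral_tendsto.1 ht f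

end Limit

section LevyKhintchine

lemma one_sub_exp_neg_pos {u : ℝ} (hu : 0 < u) : 0 < 1 - Real.exp (-u) :=
  sub_pos.2 (Real.exp_lt_one_iff.2 (neg_neg_of_pos hu))

lemma min_one_le_two_mul_one_sub_exp_neg {u : ℝ} (hu : 0 < u) :
    min 1 u ≤ 2 * (1 - Real.exp (-u)) := by
  have h : Real.exp (-u) * (1 + u) ≤ 1 := by
    calc Real.exp (-u) * (1 + u) ≤ Real.exp (-u) * Real.exp u := by
          gcongr; linarith [Real.add_one_le_exp u]
      _ = 1 := by rw [← Real.exp_add]; simp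
  have hpos := one_sub_exp_neg_pos hu
  rcases le_total u 1 with h1 | h1
  · rw [min_eq_right h1]; nlinarith [Real.exp_pos (-u)]
  · rw [min_eq_left h1]; nlinarith [Real.exp_pos (-u)]

/-- A mixture of the slopes `rpowSlope l` which does not charge `0` is a Bernstein function. -/
lemma exists_levyKhintchine_of_measure {P : Measure ℝ} [IsFiniteMeasure P]
    (hP : ∀ᵐ x ∂P, x ∈ Set.Ioc (0 : ℝ) 1) :
    ∃ (d : ℝ) (Λ : Measure ℝ), 0 ≤ d ∧ SigmaFinite Λ ∧ Λ (Set.Iic 0) = 0 ∧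
      (∫⁻ u in Set.Ioi (0 : ℝ), ENNReal.ofReal (min 1 u) ∂Λ) < ⊤ ∧
      ∀ l : ℝ, 0 < l → Integrable (rpowSlope l) P →
        ∫ x, rpowSlope l x ∂P = d * l + ∫ u in Set.Ioi (0 : ℝ), (1 - Real.exp (-l * u)) ∂Λ := by
  have hlog : Measurable fun x : ℝ => -Real.log x := Real.measurable_log.neg
  let ρ : Measure ℝ := (P.restrict (Set.Ioo 0 1)).map fun x => -Real.log x
  let g : ℝ → ℝ := fun u => 1 / (1 - Real.exp (-u))
  have hg : Measurable g := by fun_prop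
  have hg0 {u : ℝ} (hu : 0 < u) : 0 < g u := one_div_pos.2 (one_sub_exp_neg_pos hu)
  have hρ : ρ (Set.Iic 0) = 0 := by
    rw [Measure.map_apply hlog measurableSet_Iic, Measure.restrict_apply (hlog measurableSet_Iic)]
    convert measure_empty (μ := P)
    ext x
    simp only [Set.mem_inter_iff, Set.mem_preimage, Set.mem_Iic, Set.mem_Ioo,
      Set.mem_empty_iff_false, iff_false, not_and]
    intro hx h0 h1
    linarith [Real.log_neg h0 h1]
  have hρpos : ρ.restrict (Set.Ioi 0) = ρ := by
    refine Measure.restrict_eq_self_of_ae_mem ?_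
    rw [ae_iff]
    simpa [Set.Iic_def] using hρ
  let Λ : Measure ℝ := ρ.withDensity fun u => ENNReal.ofReal (g u)
  refine ⟨P.real {1}, Λ, measureReal_nonneg, inferInstance,
    withDensity_absolutelyContinuous _ _ hρ, ?_, fun l hl hint => ?_⟩
  · rw [setLIntegral_withDensity_eq_setLIntegral_mul _ hg.ennreal_ofReal (by fun_prop)
      measurableSet_Ioi]
    calc ∫⁻ u in Set.Ioi 0, ((fun u => ENNReal.ofReal (g u)) *
            fun u => ENNReal.ofReal (min 1 u)) u ∂ρ
        ≤ ∫⁻ _ in Set.Ioi (0 : ℝ), ENNReal.ofReal 2 ∂ρ := by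
          refine setLIntegral_mono measurable_const fun u hu => ?_
          rw [Pi.mul_apply, ← ENNReal.ofReal_mul (hg0 hu).le]
          refine ENNReal.ofReal_le_ofReal ?_
          rw [one_div_mul_eq_div, div_le_iff₀ (one_sub_exp_neg_pos hu)]
          exact min_one_le_two_mul_one_sub_exp_neg hu
      _ < ⊤ := by
          rw [setLIntegral_const]
          exact ENNReal.mul_lt_top ENNReal.ofReal_lt_top (measure_lt_top _ _)
  · have hΛ : ∫ u in Set.Ioi (0 : ℝ), (1 - Real.exp (-l * u)) ∂Λ =
        ∫ x in Set.Ioo 0 1, rpowSlope l x ∂P := by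
      rw [setIntegral_withDensity_eq_setIntegral_toReal_smul hg.ennreal_ofReal
        (Eventually.of_forall fun _ => ENNReal.ofReal_lt_top) _ measurableSet_Ioi, ← hρpos,
        Measure.restrict_restrict measurableSet_Ioi, Set.inter_self]
      calc ∫ u in Set.Ioi (0 : ℝ), (ENNReal.ofReal (g u)).toReal • (1 - Real.exp (-l * u)) ∂ρ
          = ∫ u, g u * (1 - Real.exp (-l * u)) ∂ρ := by
            rw [← hρpos, Measure.restrict_restrict measurableSet_Ioi, Set.inter_self]
            refine setIntegral_congr_fun measurableSet_Ioi fun u hu => ?_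
            simp only [smul_eq_mul, ENNReal.toReal_ofReal (hg0 hu).le]
        _ = ∫ x in Set.Ioo 0 1, g (-Real.log x) * (1 - Real.exp (-l * -Real.log x)) ∂P :=
            integral_map hlog.aemeasurable (by fun_prop)
        _ = ∫ x in Set.Ioo 0 1, rpowSlope l x ∂P := by
            refine setIntegral_congr_fun measurableSet_Ioo fun x hx => ?_
            simp only [g]
            rw [rpowSlope_of_ne hx.2.ne, neg_neg, Real.exp_log hx.1, neg_mul_neg, mul_comm l,
              ← Real.rpow_def_of_pos hx.1, one_div_mul_eq_div]
    rw [hΛ, ← Measure.restrict_eq_self_of_ae_mem hP, ← Set.Ioo_union_right one_pos,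
      setIntegral_union (by simp) (measurableSet_singleton 1) hint.integrableOn hint.integrableOn,
      integral_singleton, rpowSlope_one, smul_eq_mul, Set.Ioo_union_right one_pos,
      Measure.restrict_eq_self_of_ae_mem hP, add_comm]

/-- If a mixture of the slopes `rpowSlope l` vanishes as `l → 0`, the mixing measure does not
charge `0`. -/
lemma measure_zero_eq_zero_of_continuousWithinAt {ν : Measure unitInterval} [IsFiniteMeasure ν]
    {F : ℝ → ℝ} (hF : ∀ l : ℝ, 0 < l → F l = ∫ x, rpowSlope l (x : ℝ) ∂ν)
    (hF0 : F 0 = 0) (hFcont : ContinuousWithinAt F (Set.Ici 0) 0) : ν {0} = 0 := by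
  have hle (l : ℝ) (hl : 0 < l) : ν.real {0} ≤ F l := by
    have hint : Integrable (fun y : unitInterval => rpowSlope l (y : ℝ)) ν :=
      ((continuous_rpowSlope hl).comp continuous_subtype_val).integrable_of_hasCompactSupport
        (HasCompactSupport.of_compactSpace _)
    have h := setIntegral_le_integral (s := {0}) hint
      (Eventually.of_forall fun y => rpowSlope_nonneg hl y.2.1 y.2.2)
    rw [hF l hl]
    simpa [integral_singleton, rpowSlope_zero hl.ne', measureReal_def] using h
  have ht : Tendsto F (𝓝[>] 0) (𝓝 0) :=
    by simpa only [hF0] using hFcont.tendsto.mono_left (nhdsWithin_mono 0 Set.Ioi_subset_Ici_self)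
  have h0 : ν.real {0} ≤ 0 := ge_of_tendsto ht (eventually_mem_nhdsWithin.mono hle)
  exact (measureReal_eq_zero_iff (by finiteness)).1 (h0.antisymm measureReal_nonneg)

end LevyKhintchine

theorem stmt1
    (q : ℕ → ℕ → ℝ)
    (hq0 : ∀ n i, 0 ≤ q n i) (hq1 : ∀ n, ∑' i, q n i = 1)
    (b : ℕ → ℝ) (hbpos : ∀ n, 0 < b n) (hbtop : Tendsto b atTop atTop)
    (F : ℝ → ℝ)
    -- (B) : pointwise convergence to a continuous function `F` on `[0, ∞)`
    (hconv : ∀ l : ℝ, 0 ≤ l → Tendsto (fun n => Fseq q b n l) atTop (𝓝 (F l)))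
    (hFcont : ContinuousOn F (Set.Ici 0)) :
    ∃ (d : ℝ) (Λ : Measure ℝ), 0 ≤ d ∧ SigmaFinite Λ ∧ Λ (Set.Iic 0) = 0 ∧
      (∫⁻ u in Set.Ioi (0 : ℝ), ENNReal.ofReal (min 1 u) ∂Λ) < ⊤ ∧
      ∀ l : ℝ, 0 ≤ l →
        F l = d * l + ∫ u in Set.Ioi (0 : ℝ), (1 - Real.exp (-l * u)) ∂Λ := by
  choose μ hμ using fun n => exists_finiteMeasure_integral_rpowSlope (hq0 n) (hq1 n) (hbpos n) n
  obtain ⟨ν, hν⟩ := exists_finiteMeasure_of_tendsto (μ := μ) (F := F) fun l hl => by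
    simp_rw [hμ _ l hl]
    exact tendsto_pgf_exp hq0 hq1 hbpos hbtop hconv hFcont hl
  have hF0 : F 0 = 0 :=
    tendsto_nhds_unique (hconv 0 le_rfl) (by simp [Fseq_zero hq1])
  have hν0 := measure_zero_eq_zero_of_continuousWithinAt hν hF0 (hFcont 0 Set.self_mem_Ici)
  have hval : MeasurableEmbedding ((↑) : unitInterval → ℝ) :=
    MeasurableEmbedding.subtype_coe measurableSet_Icc
  have hP : ∀ᵐ x ∂(ν : Measure unitInterval).map (↑), x ∈ Set.Ioc (0 : ℝ) 1 := by
    rw [hval.ae_map_iff]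
    filter_upwards [compl_mem_ae_iff.2 hν0] with x hx
    exact ⟨unitInterval.pos_iff_ne_zero.2 hx, x.2.2⟩
  obtain ⟨d, Λ, hd, hσ, hΛ0, hΛ, h⟩ := exists_levyKhintchine_of_measure hP
  refine ⟨d, Λ, hd, hσ, hΛ0, hΛ, fun l hl => ?_⟩
  rcases hl.eq_or_lt with rfl | hl
  · simp [hF0]
  rw [← h l hl, hval.integral_map, hν l hl]
  rw [hval.integrable_map_iff]
  exact ((continuous_rpowSlope hl).comp continuous_subtype_val).integrable_of_hasCompactSupport
    (HasCompactSupport.of_compactSpace _)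
end

section
/- Under conditions (C), (E1) and (E2), the pointwise limit H of {H_n} has the representation H(λ) = β₂λ − σ₂λ² − ∫₀^∞ (e^{−λu} − 1 + λu) ν(du) for all λ ≥ 0, where β₂ ∈ ℝ, σ₂ ≥ 0 with 2σ₂ + ωγ₀ ≥ ω²γ₀, and ν is a σ-finite measure on (0, ∞) with ∫₀^∞ (u ∧ u²) ν(du) < ∞. -/
open MeasureTheory Filter Topology

/-- The mean `h'(1) = ∑ i * q i` of an `ℕ`-valued distribution `q`. -/
noncomputable def pgfMean (q : ℕ → ℝ) : ℝ := ∑' i : ℕ, (i : ℝ) * q i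

/-- `H_n(λ) = n [(1 − ω_n λ/c_n) − h_n(1 − λ/c_n)]`. -/
noncomputable def Hseq (q : ℕ → ℕ → ℝ) (c : ℕ → ℝ) (n : ℕ) (l : ℝ) : ℝ :=
  (n : ℝ) * ((1 - pgfMean (q n) * l / c n) - pgf (q n) (1 - l / c n))

/-- The remainder `e^{-v} - 1 + v` of the first-order expansion of `e^{-v}` at `0`. -/
noncomputable def expRem (v : ℝ) : ℝ := Real.exp (-v) - 1 + v

@[simp] lemma expRem_zero : expRem 0 = 0 := by simp [expRem]

lemma continuous_expRem : Continuous expRem := by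
  unfold expRem; fun_prop

lemma expRem_nonneg (v : ℝ) : 0 ≤ expRem v := by
  have := Real.one_sub_le_exp_neg v
  unfold expRem; linarith

lemma abs_expRem_sub_le {v : ℝ} (hv : |v| ≤ 1) : |expRem v - v ^ 2 / 2| ≤ |v| ^ 3 * (2 / 9) := by
  have h := Real.exp_bound (x := -v) (by simpa using hv) (n := 3) (by norm_num)
  norm_num [Finset.sum_range_succ, Nat.factorial] at h
  have e : Real.exp (-v) - (1 + -v + v ^ 2 / 2) = expRem v - v ^ 2 / 2 := by
    unfold expRem; ring
  rwa [e] at h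

lemma expRem_le_self {v : ℝ} (hv : 0 ≤ v) : expRem v ≤ v := by
  have : Real.exp (-v) ≤ 1 := Real.exp_le_one_iff.2 (by linarith)
  unfold expRem; linarith

lemma expRem_le_sq {v : ℝ} (hv : 0 ≤ v) : expRem v ≤ v ^ 2 := by
  rcases le_total v 1 with h | h
  · have h1 := (abs_le.1 (abs_expRem_sub_le (v := v) (by rwa [abs_of_nonneg hv]))).2
    rw [abs_of_nonneg hv] at h1
    nlinarith [mul_nonneg (sq_nonneg v) (sub_nonneg.2 h)]
  · exact (expRem_le_self hv).trans (by nlinarith)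

lemma min_self_sq_le_expRem {v : ℝ} (hv : 0 ≤ v) : min v (v ^ 2) ≤ 4 * expRem v := by
  rcases le_total v 1 with h | h
  · have h1 := (abs_le.1 (abs_expRem_sub_le (v := v) (by rwa [abs_of_nonneg hv]))).1
    rw [abs_of_nonneg hv] at h1
    refine (min_le_right _ _).trans ?_
    nlinarith [mul_nonneg (sq_nonneg v) (sub_nonneg.2 h)]
  · refine (min_le_left _ _).trans ?_
    have h1 := Real.add_one_le_exp (1 - v)
    have h2 : Real.exp (-v) = Real.exp (1 - v) * Real.exp (-1) := by
      rw [← Real.exp_add]; ring_nf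
    have h3 := (abs_le.1 (abs_expRem_sub_le (v := 1) (by simp)))
    norm_num [expRem] at h3
    have h4 : (2 - v) * Real.exp (-1) ≤ Real.exp (-v) := by
      rw [h2]; exact mul_le_mul_of_nonneg_right (by linarith) (Real.exp_pos _).le
    have h5 := Real.exp_neg_one_lt_half
    unfold expRem
    nlinarith

lemma expRem_pos {v : ℝ} (hv : 0 < v) : 0 < expRem v := by
  have := min_self_sq_le_expRem hv.le
  have : 0 < min v (v ^ 2) := by positivity
  linarith

lemma nat_mul_expRem_le {v : ℝ} (i : ℕ) : i * expRem v ≤ expRem (i * v) := by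
  have h := one_add_mul_le_pow (a := Real.exp (-v) - 1) (by linarith [Real.exp_pos (-v)]) i
  have e : (1 + (Real.exp (-v) - 1)) ^ i = Real.exp (-(i * v)) := by
    rw [← mul_neg, Real.exp_nat_mul]; ring
  rw [e] at h
  unfold expRem
  linarith

lemma expRem_tangent_le (a v : ℝ) :
    expRem a + (1 - Real.exp (-a)) * (v - a) ≤ expRem v := by
  have h1 := Real.add_one_le_exp (a - v)
  have h2 : Real.exp (-v) = Real.exp (a - v) * Real.exp (-a) := by
    rw [← Real.exp_add]; ring_nf
  have h3 : (a - v + 1) * Real.exp (-a) ≤ Real.exp (-v) := by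
    rw [h2]; exact mul_le_mul_of_nonneg_right h1 (Real.exp_pos _).le
  unfold expRem
  nlinarith

lemma exists_expRem_eq_mul_sq : ∃ g : ℝ → ℝ, Tendsto g (𝓝 0) (𝓝 (1 / 2)) ∧
    ∀ v, expRem v = g v * v ^ 2 := by
  refine ⟨fun v => if v = 0 then 1 / 2 else expRem v / v ^ 2, ?_, fun v => ?_⟩
  · rw [tendsto_iff_norm_sub_tendsto_zero]
    refine squeeze_zero_norm' (a := fun v : ℝ => |v|) ?_ ?_
    · filter_upwards [Metric.ball_mem_nhds (0 : ℝ) one_pos] with v hv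
      have hv1 : |v| ≤ 1 := by simpa using (Metric.mem_ball.1 hv).le
      rw [norm_norm, Real.norm_eq_abs]
      split_ifs with h
      · simp
      · have e : expRem v / v ^ 2 - 1 / 2 = (expRem v - v ^ 2 / 2) / v ^ 2 := by
          field_simp
        rw [e, abs_div, abs_of_nonneg (sq_nonneg v), div_le_iff₀ (by positivity)]
        have := abs_expRem_sub_le hv1
        have h3 : |v| * v ^ 2 = |v| ^ 3 := by rw [← sq_abs v]; ring
        have : 0 ≤ |v| ^ 3 := by positivity
        linarith
    · simpa using (continuous_abs (G := ℝ)).tendsto 0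
  · dsimp only
    split_ifs with h
    · simp [h]
    · field_simp

lemma tendsto_expRem_div_atTop : Tendsto (fun v => expRem v / v) atTop (𝓝 1) := by
  have h : Tendsto (fun v : ℝ => (Real.exp (-v) - 1) * v⁻¹ + 1) atTop (𝓝 ((0 - 1) * 0 + 1)) :=
    (((Real.tendsto_exp_neg_atTop_nhds_zero).sub_const 1).mul tendsto_inv_atTop_zero).add_const 1
  norm_num at h
  refine h.congr' ?_
  filter_upwards [eventually_gt_atTop 0] with v hv
  unfold expRem
  field_simp

/-- The continuous extension to `[0, ∞]` of `u ↦ (e^{-lu} - 1 + lu) / (e^{-u} - 1 + u)`. -/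
noncomputable def remRatio (l : ℝ) (x : ENNReal) : ℝ :=
  if x = 0 then l ^ 2 else if x = ⊤ then l else expRem (l * x.toReal) / expRem x.toReal

lemma remRatio_of_ne {l : ℝ} {x : ENNReal} (h0 : x ≠ 0) (ht : x ≠ ⊤) :
    remRatio l x = expRem (l * x.toReal) / expRem x.toReal := by simp [remRatio, h0, ht]

lemma tendsto_toReal_nhds_top :
    Tendsto ENNReal.toReal (𝓝[≠] ⊤) atTop := by
  refine tendsto_atTop.2 fun b => ?_
  have h : ∀ᶠ x : ENNReal in 𝓝[≠] ⊤, ENNReal.ofReal b < x :=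
    nhdsWithin_le_nhds (lt_mem_nhds ENNReal.ofReal_lt_top)
  filter_upwards [h, self_mem_nhdsWithin] with x hx hx'
  exact (ENNReal.ofReal_le_iff_le_toReal hx').1 hx.le

lemma continuous_remRatio {l : ℝ} (hl : 0 ≤ l) : Continuous (remRatio l) := by
  rcases hl.eq_or_lt with rfl | hl
  · have : remRatio 0 = fun _ => 0 := by
      ext x; simp [remRatio]
    rw [this]; exact continuous_const
  rw [continuous_iff_continuousAt]
  intro x
  by_cases h0 : x = 0
  · subst h0
    rw [continuousAt_iff_punctured_nhds]
    obtain ⟨g, hg, hg'⟩ := exists_expRem_eq_mul_sq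
    have ht : Tendsto ENNReal.toReal (𝓝[≠] 0) (𝓝 0) := by
      simpa using (ENNReal.tendsto_toReal (a := 0) (by simp)).mono_left nhdsWithin_le_nhds
    have ht' : Tendsto (fun x : ENNReal => l * x.toReal) (𝓝[≠] 0) (𝓝 0) := by
      simpa using ht.const_mul l
    have key := ((hg.comp ht').mul_const (l ^ 2)).div (hg.comp ht) (by norm_num)
    have e : (1 / 2 * l ^ 2 / (1 / 2) : ℝ) = remRatio l 0 := by simp [remRatio]; ring
    rw [e] at key
    refine key.congr' ?_
    have hlt : ∀ᶠ x : ENNReal in 𝓝[≠] 0, x < ⊤ :=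
      nhdsWithin_le_nhds (gt_mem_nhds ENNReal.zero_lt_top)
    filter_upwards [hlt, self_mem_nhdsWithin] with x hx hx'
    rw [remRatio_of_ne hx' hx.ne, hg', hg' x.toReal]
    have : x.toReal ≠ 0 := (ENNReal.toReal_pos hx' hx.ne).ne'
    simp only [Pi.div_apply, Function.comp_apply]
    rw [mul_pow, ← mul_assoc, mul_div_mul_right _ _ (by positivity)]
  by_cases htop : x = ⊤
  · subst htop
    rw [continuousAt_iff_punctured_nhds]
    have ht' : Tendsto (fun x : ENNReal => l * x.toReal) (𝓝[≠] ⊤) atTop :=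
      tendsto_toReal_nhds_top.const_mul_atTop hl
    have key := ((tendsto_expRem_div_atTop.comp ht').mul_const l).div
      (tendsto_expRem_div_atTop.comp tendsto_toReal_nhds_top) one_ne_zero
    have e : (1 * l / 1 : ℝ) = remRatio l ⊤ := by simp [remRatio]
    rw [e] at key
    refine key.congr' ?_
    have hlt : ∀ᶠ x : ENNReal in 𝓝[≠] ⊤, 0 < x :=
      nhdsWithin_le_nhds (lt_mem_nhds ENNReal.zero_lt_top)
    filter_upwards [hlt, self_mem_nhdsWithin] with x hx hx'
    rw [remRatio_of_ne hx.ne' hx']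
    have : 0 < x.toReal := ENNReal.toReal_pos hx.ne' hx'
    have := expRem_pos this
    simp only [Pi.div_apply, Function.comp_apply]
    field_simp
  · have hr := ENNReal.continuousAt_toReal htop
    have hpos := expRem_pos (ENNReal.toReal_pos h0 htop)
    have key : ContinuousAt (fun x : ENNReal => expRem (l * x.toReal) / expRem x.toReal) x :=
      (continuous_expRem.continuousAt.comp (continuousAt_const.mul hr)).div
        (continuous_expRem.continuousAt.comp hr) hpos.ne'
    refine key.congr ?_
    filter_upwards [isOpen_ne.mem_nhds h0, isOpen_ne.mem_nhds htop] with y hy hy'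
    exact (remRatio_of_ne hy hy').symm

lemma remRatio_nonneg {l : ℝ} (hl : 0 ≤ l) (x : ENNReal) : 0 ≤ remRatio l x := by
  unfold remRatio
  split_ifs
  · positivity
  · exact hl
  · exact div_nonneg (expRem_nonneg _) (expRem_nonneg _)

lemma remRatio_le {l : ℝ} (hl : 1 ≤ l) (x : ENNReal) : remRatio l x ≤ 4 * l ^ 2 := by
  by_cases h0 : x = 0
  · simp only [remRatio, h0, if_true]; nlinarith
  by_cases ht : x = ⊤
  · simp [remRatio, ht]; nlinarith
  rw [remRatio_of_ne h0 ht]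
  have hu := ENNReal.toReal_pos h0 ht
  set u := x.toReal
  rw [div_le_iff₀ (expRem_pos hu)]
  have h1 := min_self_sq_le_expRem hu.le
  have h2 : expRem (l * u) ≤ l ^ 2 * min u (u ^ 2) := by
    rw [mul_min_of_nonneg _ _ (by positivity)]
    have hlu : 0 ≤ l * u := by positivity
    refine le_min ((expRem_le_self hlu).trans ?_) ((expRem_le_sq hlu).trans_eq (by ring))
    exact mul_le_mul_of_nonneg_right (by nlinarith) hu.le
  nlinarith [sq_nonneg l, mul_le_mul_of_nonneg_left h1 (sq_nonneg l)]

lemma integrable_remRatio {l : ℝ} (hl : 0 ≤ l) (μ : Measure ENNReal) [IsFiniteMeasure μ] :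
    Integrable (remRatio l) μ :=
  (BoundedContinuousFunction.mkOfCompact ⟨_, continuous_remRatio hl⟩).integrable μ

/-- The atom at `0` is recovered from the quadratic growth of the integrated kernel. -/
lemma tendsto_integral_remRatio_div_sq (μ : Measure ENNReal) [IsFiniteMeasure μ] :
    Tendsto (fun l : ℝ => ∫ x, remRatio l x / l ^ 2 ∂μ) atTop (𝓝 (μ.real {0})) := by
  have e : μ.real {0} = ∫ x, Set.indicator {0} (fun _ => (1 : ℝ)) x ∂μ := by
    rw [integral_indicator_const _ (measurableSet_singleton _)]; simp
  rw [e]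
  refine tendsto_integral_filter_of_dominated_convergence (fun _ => 4) ?_ ?_
    (integrable_const _) ?_
  · filter_upwards [eventually_ge_atTop 0] with l hl
    exact ((continuous_remRatio hl).div_const _).aestronglyMeasurable
  · filter_upwards [eventually_ge_atTop 1] with l hl
    refine Eventually.of_forall fun x => ?_
    have := remRatio_nonneg (by linarith : (0 : ℝ) ≤ l) x
    rw [Real.norm_of_nonneg (by positivity), div_le_iff₀ (by positivity)]
    exact remRatio_le hl x
  · refine Eventually.of_forall fun x => ?_
    by_cases h0 : x = 0
    · subst h0
      simp only [Set.mem_singleton_iff, Set.indicator_of_mem]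
      refine tendsto_const_nhds.congr' ?_
      filter_upwards [eventually_gt_atTop 0] with l hl
      simp [remRatio, hl.ne']
    rw [Set.indicator_of_notMem (by simpa using h0)]
    have hle : ∃ C, ∀ l, 0 < l → remRatio l x ≤ C * l := by
      by_cases ht : x = ⊤
      · exact ⟨1, fun l _ => by simp [remRatio, ht]⟩
      · refine ⟨x.toReal / expRem x.toReal, fun l hl => ?_⟩
        have hp := expRem_pos (ENNReal.toReal_pos h0 ht)
        rw [remRatio_of_ne h0 ht, div_mul_eq_mul_div]
        refine div_le_div_of_nonneg_right ?_ hp.le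
        exact (expRem_le_self (by positivity)).trans_eq (mul_comm _ _)
    obtain ⟨C, hC⟩ := hle
    refine squeeze_zero' (g := fun l => C * l⁻¹) ?_ ?_ ?_
    · filter_upwards [eventually_ge_atTop 0] with l hl
      exact div_nonneg (remRatio_nonneg hl x) (sq_nonneg l)
    · filter_upwards [eventually_gt_atTop 0] with l hl
      rw [div_le_iff₀ (by positivity)]
      refine (hC l hl).trans_eq ?_
      field_simp
    · simpa using tendsto_inv_atTop_zero.const_mul C

/-- The Lévy-type measure on `(0, ∞)` obtained by dividing the part of `μ` on `(0, ∞)` by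
`e^{-u} - 1 + u`. -/
noncomputable def levyPart (μ : Measure ENNReal) : Measure ℝ :=
  ((μ.restrict (Set.Ioo 0 ⊤)).map ENNReal.toReal).withDensity
    fun u => ((expRem u)⁻¹.toNNReal : ENNReal)

lemma measurable_inv_expRem_toNNReal : Measurable fun u => (expRem u)⁻¹.toNNReal :=
  continuous_expRem.measurable.inv.real_toNNReal

instance sigmaFinite_levyPart (μ : Measure ENNReal) [IsFiniteMeasure μ] :
    SigmaFinite (levyPart μ) :=
  SigmaFinite.withDensity _

lemma levyPart_Iic (μ : Measure ENNReal) : levyPart μ (Set.Iic 0) = 0 := by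
  refine withDensity_absolutelyContinuous _ _ ?_
  rw [Measure.map_apply ENNReal.measurable_toReal measurableSet_Iic,
    Measure.restrict_apply (ENNReal.measurable_toReal measurableSet_Iic)]
  convert measure_empty (μ := μ)
  ext x
  simp only [Set.mem_inter_iff, Set.mem_preimage, Set.mem_Iic, Set.mem_Ioo, Set.mem_empty_iff_false,
    iff_false, not_and]
  intro h h1 h2
  exact absurd (ENNReal.toReal_pos h1.ne' h2.ne) h.not_gt

lemma restrict_levyPart (μ : Measure ENNReal) :
    (levyPart μ).restrict (Set.Ioi 0) = levyPart μ := by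
  refine Measure.restrict_eq_self_of_ae_mem ?_
  rw [ae_iff]
  convert levyPart_Iic μ using 2
  ext; simp

lemma lintegral_min_levyPart_lt_top (μ : Measure ENNReal) [IsFiniteMeasure μ] :
    ∫⁻ u in Set.Ioi (0 : ℝ), ENNReal.ofReal (min u (u ^ 2)) ∂(levyPart μ) < ⊤ := by
  rw [levyPart, setLIntegral_withDensity_eq_setLIntegral_mul _
    measurable_inv_expRem_toNNReal.coe_nnreal_ennreal (by fun_prop) measurableSet_Ioi]
  refine (setLIntegral_mono (g := fun _ => 4) measurable_const fun u hu => ?_).trans_lt ?_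
  · have hp := expRem_pos hu
    change ENNReal.ofReal (expRem u)⁻¹ * _ ≤ 4
    rw [← ENNReal.ofReal_mul (by positivity)]
    refine ENNReal.ofReal_le_of_le_toReal ?_
    rw [inv_mul_le_iff₀ hp, ENNReal.toReal_ofNat, mul_comm]
    exact min_self_sq_le_expRem (le_of_lt hu)
  · rw [setLIntegral_const]
    exact ENNReal.mul_lt_top (by simp) (measure_lt_top _ _)

lemma integral_expRem_levyPart (l : ℝ) (μ : Measure ENNReal) :
    ∫ u in Set.Ioi (0 : ℝ), expRem (l * u) ∂(levyPart μ)
      = ∫ x in Set.Ioo 0 ⊤, remRatio l x ∂μ := by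
  rw [restrict_levyPart, levyPart,
    integral_withDensity_eq_integral_smul measurable_inv_expRem_toNNReal,
    integral_map ENNReal.measurable_toReal.aemeasurable]
  · refine setIntegral_congr_fun measurableSet_Ioo fun x hx => ?_
    rw [remRatio_of_ne hx.1.ne' hx.2.ne, NNReal.smul_def, smul_eq_mul,
      Real.coe_toNNReal _ (inv_nonneg.2 (expRem_nonneg _)), div_eq_inv_mul]
  · refine (Measurable.aestronglyMeasurable ?_)
    have h1 := continuous_expRem.measurable
    exact measurable_inv_expRem_toNNReal.smul (h1.comp (measurable_const_mul l))

lemma integral_remRatio_eq {l : ℝ} (hl : 0 ≤ l) (μ : Measure ENNReal) [IsFiniteMeasure μ] :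
    ∫ x, remRatio l x ∂μ = μ.real {0} * l ^ 2 + μ.real {⊤} * l
      + ∫ u in Set.Ioi (0 : ℝ), expRem (l * u) ∂(levyPart μ) := by
  have hi := integrable_remRatio hl μ
  have hd : ({0, ⊤} : Set ENNReal)ᶜ = Set.Ioo 0 ⊤ := by
    ext x; simp [pos_iff_ne_zero, lt_top_iff_ne_top]
  have hs : ({0, ⊤} : Set ENNReal) = {0} ∪ {⊤} := Set.insert_eq _ _
  rw [integral_expRem_levyPart, ← hd,
    ← integral_add_compl (s := ({0, ⊤} : Set ENNReal)) (by measurability) hi]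
  congr 1
  rw [hs, setIntegral_union (by simp) (measurableSet_singleton _) hi.integrableOn hi.integrableOn,
    integral_singleton, integral_singleton]
  simp [remRatio]

/-- Suppose the functions `l ↦ ∑ i, a n i * (e^{-l x_i} - 1 + l x_i)`, with non-negative weights
`a n i` and atoms `x n i ≥ 0`, converge pointwise. Then the limit integrates `remRatio` against a
finite measure on `[0, ∞]`. -/
lemma exists_measure_of_tendsto_tsum_expRem {a x : ℕ → ℕ → ℝ} {F : ℝ → ℝ}
    (ha : ∀ n i, 0 ≤ a n i) (hx : ∀ n i, 0 ≤ x n i)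
    (hs : ∀ n, ∀ l, 0 ≤ l → Summable fun i => a n i * expRem (l * x n i))
    (hF : ∀ l, 0 ≤ l → Tendsto (fun n => ∑' i, a n i * expRem (l * x n i)) atTop (𝓝 (F l))) :
    ∃ μ : FiniteMeasure ENNReal, ∀ l, 0 ≤ l → F l = ∫ y, remRatio l y ∂(μ : Measure ENNReal) := by
  have hw : ∀ n i, 0 ≤ a n i * expRem (x n i) := fun n i => mul_nonneg (ha n i) (expRem_nonneg _)
  have hs1 : ∀ n, Summable fun i => a n i * expRem (x n i) := fun n => by
    simpa using hs n 1 zero_le_one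
  have hF1 : Tendsto (fun n => ∑' i, a n i * expRem (x n i)) atTop (𝓝 (F 1)) := by
    simpa using hF 1 zero_le_one
  let m : ℕ → Measure ENNReal := fun n => Measure.sum fun i =>
    ENNReal.ofReal (a n i * expRem (x n i)) • Measure.dirac (ENNReal.ofReal (x n i))
  have hmass : ∀ n, m n Set.univ = ENNReal.ofReal (∑' i, a n i * expRem (x n i)) := fun n => by
    rw [ENNReal.ofReal_tsum_of_nonneg (hw n) (hs1 n), Measure.sum_apply _ MeasurableSet.univ]
    simp
  have hfin : ∀ n, IsFiniteMeasure (m n) := fun n => ⟨by rw [hmass]; exact ENNReal.ofReal_lt_top⟩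
  have hint : ∀ n l, 0 ≤ l → ∫ y, remRatio l y ∂(m n) = ∑' i, a n i * expRem (l * x n i) := by
    intro n l hl
    rw [integral_sum_measure (integrable_remRatio hl _)]
    refine tsum_congr fun i => ?_
    rw [integral_smul_measure, integral_dirac, ENNReal.toReal_ofReal (hw n i), smul_eq_mul]
    rcases (hx n i).eq_or_lt with h | h
    · simp [← h]
    · have hp := expRem_pos h
      rw [remRatio_of_ne (by simpa using h) ENNReal.ofReal_ne_top, ENNReal.toReal_ofReal h.le]
      field_simp
  obtain ⟨B, hB⟩ := hF1.bddAbove_range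
  let M : ℕ → FiniteMeasure ENNReal := fun n => ⟨m n, hfin n⟩
  have hMB : ∀ n, (M n).mass ≤ B.toNNReal := by
    intro n
    rw [← ENNReal.coe_le_coe, FiniteMeasure.ennreal_mass]
    change m n Set.univ ≤ ENNReal.ofReal B
    rw [hmass]
    exact ENNReal.ofReal_le_ofReal (hB ⟨n, rfl⟩)
  let U : Ultrafilter ℕ := hyperfilter ℕ
  obtain ⟨μ, -, hμ⟩ := (isCompact_setOfPred_finiteMeasure_le_of_compactSpace ENNReal
    B.toNNReal).ultrafilter_le_nhds (U.map M)
    (le_principal_iff.2 (Filter.mem_map.2 (Filter.univ_mem' hMB)))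
  have hU : (U : Filter ℕ) ≤ atTop := Nat.hyperfilter_le_atTop
  refine ⟨μ, fun l hl => ?_⟩
  have ht : Tendsto M U (𝓝 μ) := hμ
  have h1 := FiniteMeasure.tendsto_iff_forall_integral_tendsto.1 ht
    (BoundedContinuousFunction.mkOfCompact ⟨_, continuous_remRatio hl⟩)
  refine tendsto_nhds_unique ((hF l hl).mono_left hU) (h1.congr fun n => ?_)
  exact hint n l hl

lemma tendsto_nat_mul_expRem {c v : ℕ → ℝ} {γ a : ℝ} (hc : Tendsto (fun n => (c n)⁻¹) atTop (𝓝 0))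
    (hC2 : Tendsto (fun n : ℕ => (n : ℝ) / c n ^ 2) atTop (𝓝 γ)) (hv : Tendsto v atTop (𝓝 a)) :
    Tendsto (fun n : ℕ => n * expRem (v n / c n)) atTop (𝓝 (γ * a ^ 2 / 2)) := by
  obtain ⟨g, hg, hg'⟩ := exists_expRem_eq_mul_sq
  have h0 : Tendsto (fun n => v n / c n) atTop (𝓝 0) := by
    simpa [div_eq_mul_inv] using hv.mul hc
  have key := (hg.comp h0).mul (hC2.mul (hv.pow 2))
  have e : 1 / 2 * (γ * a ^ 2) = γ * a ^ 2 / 2 := by ring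
  rw [e] at key
  refine key.congr fun n => ?_
  rw [hg']
  simp only [Function.comp_apply]
  ring

section Distribution

variable {q : ℕ → ℝ} (hq0 : ∀ i, 0 ≤ q i) (hq1 : ∑' i, q i = 1)
  (hqm : Summable fun i : ℕ => (i : ℝ) * q i)

include hq1 in
lemma summable_of_tsum_eq_one_s3 : Summable q := by
  by_contra h
  simp [tsum_eq_zero_of_not_summable h] at hq1

include hq0 hqm in
lemma summable_mul_expRem {v : ℝ} (hv : 0 ≤ v) : Summable fun i : ℕ => q i * expRem (i * v) := by
  refine Summable.of_nonneg_of_le (fun i => mul_nonneg (hq0 i) (expRem_nonneg _)) (fun i => ?_)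
    (hqm.mul_right v)
  have := mul_le_mul_of_nonneg_left (expRem_le_self (v := i * v) (by positivity)) (hq0 i)
  linarith

include hq0 hqm in
lemma pgfMean_mul_expRem_le {v : ℝ} (hv : 0 ≤ v) :
    pgfMean q * expRem v ≤ ∑' i : ℕ, q i * expRem (i * v) := by
  rw [pgfMean, ← tsum_mul_right]
  refine (hqm.mul_right _).tsum_le_tsum (fun i => ?_) (summable_mul_expRem hq0 hqm hv)
  have := mul_le_mul_of_nonneg_left (nat_mul_expRem_le (v := v) i) (hq0 i)
  linarith

include hq0 hq1 hqm in
lemma expRem_pgfMean_le {v : ℝ} (hv : 0 ≤ v) :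
    expRem (pgfMean q * v) ≤ ∑' i : ℕ, q i * expRem (i * v) := by
  set w := pgfMean q with hw
  set d := 1 - Real.exp (-(w * v))
  have hs := summable_of_tsum_eq_one_s3 hq1
  have h1 : HasSum (fun i : ℕ => q i * (expRem (w * v) - d * (w * v)) + i * q i * (d * v))
      (1 * (expRem (w * v) - d * (w * v)) + w * (d * v)) :=
    ((hq1 ▸ hs.hasSum).mul_right _).add (hqm.hasSum.mul_right _)
  have e : 1 * (expRem (w * v) - d * (w * v)) + w * (d * v) = expRem (w * v) := by ring
  rw [e] at h1
  refine hasSum_le (fun i => ?_) h1 (summable_mul_expRem hq0 hqm hv).hasSum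
  have := mul_le_mul_of_nonneg_left (expRem_tangent_le (w * v) (i * v)) (hq0 i)
  linarith

include hq0 hq1 hqm in
lemma tsum_mul_expRem_eq {v : ℝ} (hv : 0 ≤ v) :
    ∑' i : ℕ, q i * expRem (i * v) = pgf q (Real.exp (-v)) - 1 + pgfMean q * v := by
  have hs := summable_of_tsum_eq_one_s3 hq1
  have hp : Summable fun i : ℕ => q i * Real.exp (-v) ^ i := by
    refine Summable.of_nonneg_of_le (fun i => mul_nonneg (hq0 i) (by positivity)) (fun i => ?_) hs
    exact mul_le_of_le_one_right (hq0 i)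
      (pow_le_one₀ (Real.exp_pos _).le (Real.exp_le_one_iff.2 (by linarith)))
  have h := (hp.hasSum.sub (hq1 ▸ hs.hasSum)).add (hqm.hasSum.mul_right v)
  refine (h.congr_fun ?_).tsum_eq
  intro i
  rw [expRem, ← mul_neg, Real.exp_nat_mul]
  ring

end Distribution

theorem stmt3
    (q : ℕ → ℕ → ℝ)
    (hq0 : ∀ n i, 0 ≤ q n i) (hq1 : ∀ n, ∑' i, q n i = 1)
    -- the immigration means `ω_n` are finite
    (hqm : ∀ n, Summable fun i : ℕ => (i : ℝ) * q n i)
    (c : ℕ → ℝ) (hcpos : ∀ n, 0 < c n)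
    (γ₀ ω : ℝ) (hγ₀ : 0 ≤ γ₀) (hω : 0 ≤ ω)
    -- condition (C)
    (hC1 : Tendsto (fun n : ℕ => (n : ℝ) / c n) atTop atTop)
    (hC2 : Tendsto (fun n : ℕ => (n : ℝ) / c n ^ 2) atTop (𝓝 γ₀))
    -- condition (E1)
    (hE1 : Tendsto (fun n : ℕ => pgfMean (q n)) atTop (𝓝 ω))
    -- condition (E2)
    (H : ℝ → ℝ)
    (hHlip : ∀ M > (0 : ℝ), ∃ K : ℝ, ∀ (n : ℕ) (l l' : ℝ),
      l ∈ Set.Icc 0 M → l' ∈ Set.Icc 0 M → l ≤ c n → l' ≤ c n →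
      |Hseq q c n l - Hseq q c n l'| ≤ K * |l - l'|)
    (hHlim : ∀ l : ℝ, 0 ≤ l → Tendsto (fun n => Hseq q c n l) atTop (𝓝 (H l)))
    (hHcont : ContinuousOn H (Set.Ici 0)) :
    ∃ (β₂ σ₂ : ℝ) (ν : Measure ℝ), 0 ≤ σ₂ ∧ ω ^ 2 * γ₀ ≤ 2 * σ₂ + ω * γ₀ ∧
      SigmaFinite ν ∧ ν (Set.Iic 0) = 0 ∧
      (∫⁻ u in Set.Ioi (0 : ℝ), ENNReal.ofReal (min u (u ^ 2)) ∂ν) < ⊤ ∧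
      ∀ l : ℝ, 0 ≤ l →
        H l = β₂ * l - σ₂ * l ^ 2
          - ∫ u in Set.Ioi (0 : ℝ), (Real.exp (-l * u) - 1 + l * u) ∂ν := by
  have hcinv : Tendsto (fun n => (c n)⁻¹) atTop (𝓝 0) := by
    refine (hC2.div_atTop hC1).congr' ?_
    filter_upwards [eventually_gt_atTop 0] with n hn
    have := hcpos n
    have : (0 : ℝ) < n := by exact_mod_cast hn
    field_simp
  let F : ℕ → ℝ → ℝ := fun n l => n * ∑' i : ℕ, q n i * expRem (i * (l / c n))
  have hFeq : ∀ n l, 0 ≤ l → F n l = -Hseq q c n (l - c n * expRem (l / c n))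
      + n * expRem (l / c n) * pgfMean (q n) := by
    intro n l hl
    have hc := hcpos n
    have e : 1 - (l - c n * expRem (l / c n)) / c n = Real.exp (-(l / c n)) := by
      unfold expRem; field_simp; ring
    simp only [F, Hseq]
    rw [tsum_mul_expRem_eq (hq0 n) (hq1 n) (hqm n) (by positivity), e]
    field_simp
    ring
  have hrem : ∀ l, Tendsto (fun n : ℕ => n * expRem (l / c n)) atTop (𝓝 (γ₀ * l ^ 2 / 2)) :=
    fun l => tendsto_nat_mul_expRem hcinv hC2 tendsto_const_nhds
  have hshift : ∀ l, Tendsto (fun n => c n * expRem (l / c n)) atTop (𝓝 0) := by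
    intro l
    refine ((hrem l).div_atTop hC1).congr' ?_
    filter_upwards [eventually_gt_atTop 0] with n hn
    have := hcpos n
    have : (0 : ℝ) < n := by exact_mod_cast hn
    field_simp
  have hFlim : ∀ l, 0 ≤ l → Tendsto (fun n => F n l) atTop
      (𝓝 (-H l + γ₀ * l ^ 2 / 2 * ω)) := by
    intro l hl
    obtain ⟨K, hK⟩ := hHlip (l + 1) (by linarith)
    have hdiff : Tendsto (fun n => Hseq q c n (l - c n * expRem (l / c n)) - Hseq q c n l) atTop
        (𝓝 0) := by
      refine squeeze_zero_norm' (a := fun n => K * |c n * expRem (l / c n)|) ?_ ?_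
      · have h1 : ∀ᶠ n in atTop, l * (c n)⁻¹ < 1 := by
          have h2 := hcinv.const_mul l
          rw [mul_zero] at h2
          exact h2.eventually_lt_const one_pos
        filter_upwards [h1] with n hn
        have hc := hcpos n
        have hlc : l ≤ c n := by
          rw [← div_eq_mul_inv, div_lt_one hc] at hn; exact hn.le
        have h3 : c n * expRem (l / c n) ≤ l :=
          (mul_le_mul_of_nonneg_left (expRem_le_self (by positivity)) hc.le).trans_eq
            (by field_simp)
        have h4 : 0 ≤ c n * expRem (l / c n) := mul_nonneg hc.le (expRem_nonneg _)
        refine (hK n _ l ⟨by linarith, by linarith⟩ ⟨hl, by linarith⟩ (by linarith) hlc).trans_eq ?_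
        rw [sub_sub_cancel_left, abs_neg]
      · simpa using (hshift l).abs.const_mul K
    have hlim := hdiff.add (hHlim l hl)
    simp only [sub_add_cancel, zero_add] at hlim
    exact (hlim.neg.add ((hrem l).mul hE1)).congr fun n => (hFeq n l hl).symm
  have hlow1 : ∀ l, 0 ≤ l → γ₀ * l ^ 2 / 2 * ω ≤ -H l + γ₀ * l ^ 2 / 2 * ω := by
    intro l hl
    refine le_of_tendsto_of_tendsto' ((hrem l).mul hE1) (hFlim l hl) fun n => ?_
    have := hcpos n
    have := mul_le_mul_of_nonneg_left (pgfMean_mul_expRem_le (hq0 n) (hqm n)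
      (v := l / c n) (by positivity)) (Nat.cast_nonneg (α := ℝ) n)
    linarith
  have hlow2 : ∀ l, 0 ≤ l → γ₀ * (ω * l) ^ 2 / 2 ≤ -H l + γ₀ * l ^ 2 / 2 * ω := by
    intro l hl
    refine le_of_tendsto_of_tendsto' (tendsto_nat_mul_expRem hcinv hC2 (hE1.mul_const l))
      (hFlim l hl) fun n => ?_
    have := hcpos n
    rw [mul_div_assoc]
    exact mul_le_mul_of_nonneg_left (expRem_pgfMean_le (hq0 n) (hq1 n) (hqm n)
      (v := l / c n) (by positivity)) (Nat.cast_nonneg (α := ℝ) n)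
  have hterm : ∀ (n : ℕ) (l : ℝ) (i : ℕ), (n : ℝ) * (q n i * expRem (i * (l / c n)))
      = n * q n i * expRem (l * (i / c n)) := by
    intro n l i
    rw [show l * ((i : ℝ) / c n) = i * (l / c n) by ring, mul_assoc]
  obtain ⟨μ, hμ⟩ := exists_measure_of_tendsto_tsum_expRem
    (a := fun n i => n * q n i) (x := fun n i => i / c n)
    (F := fun l => -H l + γ₀ * l ^ 2 / 2 * ω)
    (fun n i => mul_nonneg (Nat.cast_nonneg _) (hq0 n i))
    (fun n i => div_nonneg (Nat.cast_nonneg _) (hcpos n).le)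
    (fun n l hl => by
      simp only [← hterm]
      exact (summable_mul_expRem (hq0 n) (hqm n) (div_nonneg hl (hcpos n).le)).mul_left _)
    (fun l hl => by
      simp only [← hterm, tsum_mul_left]
      exact hFlim l hl)
  have hatom : ∀ b : ℝ, (∀ l, 0 ≤ l → b * l ^ 2 ≤ -H l + γ₀ * l ^ 2 / 2 * ω) →
      b ≤ (μ : Measure ENNReal).real {0} := by
    intro b hb
    refine ge_of_tendsto (tendsto_integral_remRatio_div_sq μ) ?_
    filter_upwards [eventually_gt_atTop 0] with l hl
    rw [integral_div, ← hμ l hl.le, le_div_iff₀ (by positivity)]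
    exact hb l hl.le
  have hb1 := hatom (γ₀ * ω / 2) fun l hl => by linarith [hlow1 l hl]
  have hb2 := hatom (γ₀ * ω ^ 2 / 2) fun l hl => by linarith [hlow2 l hl]
  refine ⟨-(μ : Measure ENNReal).real {⊤}, (μ : Measure ENNReal).real {0} - γ₀ * ω / 2,
    levyPart μ, by linarith, by linarith, inferInstance, levyPart_Iic _,
    lintegral_min_levyPart_lt_top _, fun l hl => ?_⟩
  have h := hμ l hl
  rw [integral_remRatio_eq hl] at h
  simp only [expRem, ← neg_mul] at h
  linarith
end
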